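/- Let q = 3^s with s ≥ 2, regard GF(q) as a subfield of GF(q²), and let γ ∈ GF(q²) be an element of multiplicative order q + 1. Let C = {c ∈ GF(q)^{q+1} : Σ_{i=0}^{q} c_i γ^i = 0 and Σ_{i=0}^{q} c_i γ^{2i} = 0} (equalities in GF(q²)); C is the narrow-sense BCH code of length q + 1 and designed distance 3 over GF(q). Then the extended code C̄ of C has length q + 2, dimension q − 3, and minimum distance 5; the dual code (C̄)⊥ has dimension 5 and minimum distance q − 3; and (C̄)⊥ has minimum linear locality 4. -/

import Mathlib

open scoped BigOperators

variable {F : Type*} [Field F] {ι : Type*} [Fintype ι]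

/-- The Hamming weight of a word: the number of nonzero coordinates. -/
noncomputable def wt (c : ι → F) : ℕ := {i | c i ≠ 0}.ncard

/-- The minimum distance of a linear code: the least Hamming weight of a nonzero codeword. -/
noncomputable def minDist (C : Submodule F (ι → F)) : ℕ :=
  sInf {w | ∃ c ∈ C, c ≠ 0 ∧ wt c = w}

/-- The dual code of a linear code. -/
def dualCode (C : Submodule F (ι → F)) : Submodule F (ι → F) where
  carrier := {x | ∀ c ∈ C, ∑ i, x i * c i = 0}
  add_mem' := by
    intro a b ha hb c hc
    have h1 := ha c hc
    have h2 := hb c hc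
    simp only [Set.mem_setOf_eq, Pi.add_apply, add_mul, Finset.sum_add_distrib, h1, h2, add_zero]
  zero_mem' := by intro c hc; simp
  smul_mem' := by
    intro r a ha c hc
    have h := ha c hc
    simp only [Set.mem_setOf_eq, Pi.smul_apply, smul_eq_mul, mul_assoc, ← Finset.mul_sum, h,
      mul_zero]

/-- `C` has linear locality `r`: every code symbol `c i` is a fixed linear combination of
at most `r` other code symbols. -/
def HasLinearLocality (C : Submodule F (ι → F)) (r : ℕ) : Prop :=
  ∀ i : ι, ∃ (R : Finset ι) (u : ι → F), i ∉ R ∧ R.card ≤ r ∧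
    ∀ c ∈ C, c i = ∑ j ∈ R, u j * c j

/-- The extended code of a code of length `n`: append an overall parity-check coordinate. -/
def extendedCode {n : ℕ} (C : Submodule F (Fin n → F)) : Submodule F (Fin (n + 1) → F) where
  carrier := {x | (fun i : Fin n => x i.castSucc) ∈ C ∧ ∑ i, x i = 0}
  add_mem' := by
    rintro a b ⟨ha1, ha2⟩ ⟨hb1, hb2⟩
    exact ⟨C.add_mem ha1 hb1, by simp [Finset.sum_add_distrib, ha2, hb2]⟩
  zero_mem' := ⟨C.zero_mem, by simp⟩
  smul_mem' := by
    rintro r a ⟨ha1, ha2⟩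
    exact ⟨C.smul_mem r ha1, by
      simp only [Pi.smul_apply, smul_eq_mul, ← Finset.mul_sum, ha2, mul_zero]⟩

theorem mem_dualCode {C : Submodule F (ι → F)} {x : ι → F} :
    x ∈ dualCode C ↔ ∀ c ∈ C, ∑ i, x i * c i = 0 := Iff.rfl

theorem finrank_add_finrank_dualCode (C : Submodule F (ι → F)) :
    Module.finrank F C + Module.finrank F (dualCode C) = Fintype.card ι := by
  classical
  have h : dualCode C = C.dualAnnihilator.comap (dotProductEquiv F ι).toLinearMap := by
    ext x
    simp [mem_dualCode, Submodule.mem_dualAnnihilator, dotProduct]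
  have e : Module.finrank F (dualCode C) = Module.finrank F C.dualAnnihilator := by
    rw [h]
    exact ((dotProductEquiv F ι).ofSubmodule' C.dualAnnihilator).finrank_eq
  rw [e, Subspace.finrank_add_finrank_dualAnnihilator_eq, Module.finrank_fintype_fun_eq_card]

theorem dualCode_dualCode (C : Submodule F (ι → F)) : dualCode (dualCode C) = C := by
  have hle : C ≤ dualCode (dualCode C) := fun c hc x hx => by
    simpa only [mul_comm] using hx c hc
  refine (Submodule.eq_of_le_of_finrank_eq hle ?_).symm
  have h1 := finrank_add_finrank_dualCode C
  have h2 := finrank_add_finrank_dualCode (dualCode C)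
  omega

theorem wt_eq_card [DecidableEq F] (c : ι → F) :
    wt c = (Finset.univ.filter fun i => c i ≠ 0).card := by
  rw [wt, ← Set.ncard_coe_finset]
  simp

theorem wt_le_card {κ : Type*} {c : κ → F} {S : Finset κ}
    (h : ∀ i, c i ≠ 0 → i ∈ S) : wt c ≤ S.card := by
  rw [wt, ← Set.ncard_coe_finset]
  exact Set.ncard_le_ncard (fun i hi => h i hi) S.finite_toSet

theorem minDist_eq {κ : Type*} {C : Submodule F (κ → F)} {d : ℕ}
    (hd : ∀ c ∈ C, c ≠ 0 → d ≤ wt c)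
    (h : ∃ c ∈ C, c ≠ 0 ∧ wt c ≤ d) : minDist C = d := by
  obtain ⟨c, hc, h0, hw⟩ := h
  refine IsLeast.csInf_eq ⟨⟨c, hc, h0, le_antisymm hw (hd c hc h0)⟩, ?_⟩
  rintro _ ⟨c, hc, h0, rfl⟩
  exact hd c hc h0

theorem hasLinearLocality_dualCode_iff {C : Submodule F (ι → F)} {r : ℕ} :
    HasLinearLocality (dualCode C) r ↔ ∀ i, ∃ w ∈ C, w i ≠ 0 ∧ wt w ≤ r + 1 := by
  classical
  refine forall_congr' fun i => ⟨?_, ?_⟩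
  · rintro ⟨R, u, hi, hR, h⟩
    refine ⟨fun j => if j = i then 1 else if j ∈ R then -u j else 0, ?_, by simp, ?_⟩
    · rw [← dualCode_dualCode C]
      intro c hc
      rw [← Finset.add_sum_erase _ _ (Finset.mem_univ i)]
      simp only [if_true, one_mul]
      rw [h c hc, ← Finset.sum_subset (s₁ := R) (s₂ := Finset.univ.erase i)]
      · rw [← Finset.sum_add_distrib]
        refine Finset.sum_eq_zero fun j hj => ?_
        rw [if_neg (ne_of_mem_of_not_mem hj hi), if_pos hj]
        ring
      · intro j hj
        exact Finset.mem_erase_of_ne_of_mem (ne_of_mem_of_not_mem hj hi) (Finset.mem_univ j)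
      · intro j hj hjR
        rw [if_neg (Finset.ne_of_mem_erase hj), if_neg hjR, zero_mul]
    · refine (wt_le_card (S := insert i R) fun j hj => ?_).trans
        ((Finset.card_insert_le _ _).trans (by omega))
      by_contra hn
      rw [Finset.mem_insert, not_or] at hn
      simp [hn.1, hn.2] at hj
  · rintro ⟨w, hw, hwi, hwt⟩
    have hmem : i ∈ Finset.univ.filter fun j => w j ≠ 0 := by simpa using hwi
    refine ⟨(Finset.univ.filter fun j => w j ≠ 0).erase i, fun j => -(w j / w i), by simp, ?_, ?_⟩
    · rw [Finset.card_erase_of_mem hmem, ← wt_eq_card]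
      omega
    · intro c hc
      have h1 := hc w hw
      rw [← Finset.sum_subset (Finset.subset_univ (Finset.univ.filter fun j => w j ≠ 0)) (by
        intro j _ hj
        have : w j = 0 := by simpa using hj
        rw [this, mul_zero]), ← Finset.add_sum_erase _ _ hmem] at h1
      have h2 : ∑ j ∈ (Finset.univ.filter fun j => w j ≠ 0).erase i, -(w j / w i) * c j =
          -(∑ j ∈ (Finset.univ.filter fun j => w j ≠ 0).erase i, c j * w j) / w i := by
        rw [← Finset.sum_neg_distrib, Finset.sum_div]
        refine Finset.sum_congr rfl fun j _ => ?_
        ring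
      rw [h2, eq_div_iff hwi]
      linear_combination h1

theorem mem_extendedCode {n : ℕ} {C : Submodule F (Fin n → F)} {x : Fin (n + 1) → F} :
    x ∈ extendedCode C ↔ (fun i : Fin n => x i.castSucc) ∈ C ∧ ∑ i, x i = 0 := Iff.rfl

/-- The words `(a + Tr(b γ ^ i) + Tr(c γ ^ (2 i)))ᵢ`, extended by the coordinate `a`. -/
noncomputable def traceWord {E : Type*} [Field E] [Algebra F E] (γ : E) (n : ℕ) :
    F × E × E →ₗ[F] (Fin (n + 1) → F) where
  toFun v := Fin.snoc (fun i : Fin n => v.1 + Algebra.trace F E (v.2.1 * γ ^ (i : ℕ)) +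
    Algebra.trace F E (v.2.2 * γ ^ (2 * (i : ℕ)))) v.1
  map_add' v w := by
    ext i
    refine Fin.lastCases ?_ (fun i => ?_) i
    · simp
    · simp [add_mul]
      ring
  map_smul' r v := by
    ext i
    refine Fin.lastCases ?_ (fun i => ?_) i
    · simp
    · simp [mul_add]

section

variable {E : Type*} [Field E] [Algebra F E]

theorem traceWord_castSucc (γ : E) (n : ℕ) (v : F × E × E) (i : Fin n) :
    traceWord γ n v i.castSucc = v.1 + Algebra.trace F E (v.2.1 * γ ^ (i : ℕ)) +
      Algebra.trace F E (v.2.2 * γ ^ (2 * (i : ℕ))) := by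
  simp [traceWord]

theorem traceWord_last (γ : E) (n : ℕ) (v : F × E × E) :
    traceWord γ n v (Fin.last n) = v.1 := by
  simp [traceWord]

theorem sum_mul_traceWord (γ : E) (n : ℕ) (v : F × E × E) (x : Fin (n + 1) → F) :
    ∑ i, x i * traceWord γ n v i = v.1 * ∑ i, x i +
      Algebra.trace F E (v.2.1 * ∑ i : Fin n, x i.castSucc • γ ^ (i : ℕ)) +
      Algebra.trace F E (v.2.2 * ∑ i : Fin n, x i.castSucc • γ ^ (2 * (i : ℕ))) := by
  simp only [Fin.sum_univ_castSucc, traceWord_castSucc, traceWord_last, Finset.mul_sum, map_sum,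
    mul_smul_comm, map_smul, smul_eq_mul, mul_add, Finset.sum_add_distrib]
  simp only [mul_comm v.1]
  ring

theorem dualCode_range_traceWord [FiniteDimensional F E] [Algebra.IsSeparable F E] {n : ℕ} {γ : E}
    {C : Submodule F (Fin n → F)}
    (hC : ∀ c : Fin n → F, c ∈ C ↔ ((∑ i : Fin n, c i • γ ^ (i : ℕ)) = 0 ∧
      (∑ i : Fin n, c i • γ ^ (2 * (i : ℕ))) = 0)) :
    dualCode (LinearMap.range (traceWord (F := F) γ n)) = extendedCode C := by
  have key : ∀ y : E, (∀ b : E, Algebra.trace F E (b * y) = 0) → y = 0 := fun y hy =>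
    (traceForm_nondegenerate F E).1 y fun b => by
      rw [Algebra.traceForm_apply, mul_comm]
      exact hy b
  ext x
  rw [mem_dualCode, mem_extendedCode, hC]
  simp only [LinearMap.mem_range, forall_exists_index, forall_apply_eq_imp_iff, sum_mul_traceWord]
  refine ⟨fun h => ⟨⟨key _ fun b => ?_, key _ fun b => ?_⟩, ?_⟩, ?_⟩
  · simpa using h (0, b, 0)
  · simpa using h (0, 0, b)
  · simpa using h (1, 0, 0)
  · rintro ⟨⟨h1, h2⟩, h3⟩ v
    simp [h1, h2, h3]

theorem finrank_eq_two [Fintype F] [Fintype E] {q : ℕ} (hF : Fintype.card F = q)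
    (hE : Fintype.card E = q ^ 2) : Module.finrank F E = 2 := by
  have h := Module.card_eq_pow_finrank (K := F) (V := E)
  rw [hE, hF] at h
  exact (Nat.pow_right_injective (hF ▸ Fintype.one_lt_card) h).symm

theorem algebraMap_trace_eq_add_pow [Fintype F] [Fintype E] {q : ℕ} (hF : Fintype.card F = q)
    (hE : Fintype.card E = q ^ 2) (y : E) :
    algebraMap F E (Algebra.trace F E y) = y + y ^ q := by
  rw [FiniteField.algebraMap_trace_eq_sum_pow, finrank_eq_two hF hE, Nat.card_eq_fintype_card, hF]
  simp [Finset.sum_range_succ]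

theorem card_zeros_traceWord_le [Fintype F] [Fintype E] {q : ℕ} {γ : E}
    (hF : Fintype.card F = q) (hE : Fintype.card E = q ^ 2) (hγ : IsPrimitiveRoot γ (q + 1))
    {v : F × E × E} (hv : v ≠ 0) {S : Finset (Fin (q + 1))}
    (hS : ∀ i ∈ S, traceWord γ (q + 1) v i.castSucc = 0) : S.card ≤ 4 := by
  classical
  obtain ⟨a, b, c⟩ := v
  by_contra! hcard
  obtain ⟨b', hb'⟩ : ∃ b', b' = b ^ q := ⟨_, rfl⟩
  obtain ⟨c', hc'⟩ : ∃ c', c' = c ^ q := ⟨_, rfl⟩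
  let p : Polynomial E := Polynomial.C c * Polynomial.X ^ 4 + Polynomial.C b * Polynomial.X ^ 3 +
    Polynomial.C (algebraMap F E a) * Polynomial.X ^ 2 + Polynomial.C b' * Polynomial.X +
    Polynomial.C c'
  have hdeg : p.natDegree ≤ 4 := by
    simp only [p]
    compute_degree
  have hinj : Function.Injective fun i : Fin (q + 1) => γ ^ (i : ℕ) := fun i j h =>
    Fin.ext (hγ.pow_inj i.2 j.2 h)
  have hp : p = 0 := by
    refine Polynomial.eq_zero_of_natDegree_lt_card_of_eval_eq_zero' p
      (S.image fun i : Fin (q + 1) => γ ^ (i : ℕ)) ?_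
      (by rw [Finset.card_image_of_injective _ hinj]; omega)
    simp only [Finset.mem_image, forall_exists_index, and_imp, forall_apply_eq_imp_iff₂]
    intro i hi
    have h := congrArg (algebraMap F E) (hS i hi)
    simp only [traceWord_castSucc, map_add, algebraMap_trace_eq_add_pow hF hE, map_zero] at h
    have hx : (γ ^ (i : ℕ)) * (γ ^ (i : ℕ)) ^ q = 1 := by
      rw [← pow_succ', pow_right_comm, hγ.pow_eq_one, one_pow]
    rw [mul_comm 2, pow_mul γ] at h
    simp only [mul_pow, pow_right_comm _ 2 q, ← hb', ← hc'] at h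
    generalize γ ^ (i : ℕ) = x at h hx
    generalize x ^ q = y at h hx
    simp only [p, Polynomial.eval_add, Polynomial.eval_mul, Polynomial.eval_C, Polynomial.eval_pow,
      Polynomial.eval_X]
    linear_combination x ^ 2 * h - b' * x * hx - c' * (x * y + 1) * hx
  have h4 : c = 0 := by
    simpa [p, Polynomial.coeff_X, Polynomial.coeff_C] using congrArg (Polynomial.coeff · 4) hp
  have h3 : b = 0 := by
    simpa [p, Polynomial.coeff_X, Polynomial.coeff_C] using congrArg (Polynomial.coeff · 3) hp
  have h2 : a = 0 := by
    simpa [p, Polynomial.coeff_X, Polynomial.coeff_C] using congrArg (Polynomial.coeff · 2) hp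
  exact hv (by simp [h2, h3, h4])

/-- In characteristic three, the columns `(1, x, x³, x⁴)` at three distinct points are
linearly independent. -/
theorem eq_zero_of_moments_three (h3 : (3 : E) = 0) {x d : ι → E} (hx : Function.Injective x)
    {T : Finset ι} (hT : T.card = 3) (hd : ∀ i, d i ≠ 0 → i ∈ T) (m0 : ∑ i, d i = 0)
    (m1 : ∑ i, d i * x i = 0) (m3 : ∑ i, d i * x i ^ 3 = 0) (m4 : ∑ i, d i * x i ^ 4 = 0) :
    d = 0 := by
  classical
  funext i
  by_contra hi
  replace hi : d i ≠ 0 := hi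
  have hiT := hd i hi
  obtain ⟨a, b, hab, hTab⟩ := Finset.card_eq_two.mp
    (show (T.erase i).card = 2 by rw [Finset.card_erase_of_mem hiT, hT])
  have ha : a ≠ i := Finset.ne_of_mem_erase (hTab ▸ Finset.mem_insert_self a {b})
  have hb : b ≠ i := Finset.ne_of_mem_erase (hTab ▸ by simp : b ∈ T.erase i)
  have hsum : ∀ f : ι → E, ∑ j, d j * f j = d i * f i + (d a * f a + d b * f b) := fun f => by
    rw [← Finset.sum_subset (Finset.subset_univ T) fun j _ hj => by
      rw [not_imp_comm.mp (hd j) hj, zero_mul], ← Finset.add_sum_erase _ _ hiT, hTab,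
      Finset.sum_pair hab]
  have m0' := hsum fun _ => 1
  simp only [mul_one, m0] at m0'
  rw [hsum] at m1 m3 m4
  have hia : x i - x a ≠ 0 := sub_ne_zero.mpr fun h => ha (hx h).symm
  have hib : x i - x b ≠ 0 := sub_ne_zero.mpr fun h => hb (hx h).symm
  have hxab : x a - x b ≠ 0 := sub_ne_zero.mpr fun h => hab (hx h)
  have e1 : d i * (x i - x a) * (x i - x b) * (x i + x a + x b) = 0 := by
    linear_combination m3 - (x a ^ 2 + x a * x b + x b ^ 2) * m1 -
      x a * x b * (x a + x b) * m0'
  have e2 : d i * (x i - x a) * (x i - x b) *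
      (x i ^ 2 + (x a + x b) * x i + (x a - x b) ^ 2) = 0 := by
    linear_combination m4 + (x a + x b) * (x a * x b - (x a - x b) ^ 2) * m1 -
      x a * x b * (x a - x b) ^ 2 * m0' -
      x a * x b * (d i * x i ^ 2 + d a * x a ^ 2 + d b * x b ^ 2) * h3
  simp only [mul_eq_zero, hi, hia, hib, false_or] at e1 e2
  exact pow_ne_zero 2 hxab (by linear_combination e2 - x i * e1)

theorem eq_zero_of_moments_four {x d : ι → E} (hx : Function.Injective x)
    {T : Finset ι} (hT : T.card = 4) (hd : ∀ i, d i ≠ 0 → i ∈ T) (m0 : ∑ i, d i = 0)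
    (m1 : ∑ i, d i * x i = 0) (m2 : ∑ i, d i * x i ^ 2 = 0) (m3 : ∑ i, d i * x i ^ 3 = 0) :
    d = 0 := by
  classical
  funext i
  by_contra hi
  replace hi : d i ≠ 0 := hi
  have hiT := hd i hi
  obtain ⟨a, b, c, hab, hac, hbc, hTabc⟩ := Finset.card_eq_three.mp
    (show (T.erase i).card = 3 by rw [Finset.card_erase_of_mem hiT, hT])
  have ha : a ≠ i := Finset.ne_of_mem_erase (hTabc ▸ by simp : a ∈ T.erase i)
  have hb : b ≠ i := Finset.ne_of_mem_erase (hTabc ▸ by simp : b ∈ T.erase i)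
  have hc : c ≠ i := Finset.ne_of_mem_erase (hTabc ▸ by simp : c ∈ T.erase i)
  have hsum : ∀ f : ι → E,
      ∑ j, d j * f j = d i * f i + (d a * f a + (d b * f b + d c * f c)) := fun f => by
    rw [← Finset.sum_subset (Finset.subset_univ T) fun j _ hj => by
      rw [not_imp_comm.mp (hd j) hj, zero_mul], ← Finset.add_sum_erase _ _ hiT, hTabc,
      Finset.sum_insert (by simp [hab, hac]), Finset.sum_pair hbc]
  have m0' := hsum fun _ => 1
  simp only [mul_one, m0] at m0'
  rw [hsum] at m1 m2 m3
  have hia : x i - x a ≠ 0 := sub_ne_zero.mpr fun h => ha (hx h).symm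
  have hib : x i - x b ≠ 0 := sub_ne_zero.mpr fun h => hb (hx h).symm
  have hic : x i - x c ≠ 0 := sub_ne_zero.mpr fun h => hc (hx h).symm
  have e : d i * (x i - x a) * (x i - x b) * (x i - x c) = 0 := by
    linear_combination m3 - (x a + x b + x c) * m2 +
      (x a * x b + x a * x c + x b * x c) * m1 + x a * x b * x c * m0'
  simp only [mul_eq_zero, hia, hib, hic, or_false] at e
  exact hi e

theorem five_le_wt_of_mem_extendedCode [Fintype F] {q : ℕ} {γ : E} (h3 : (3 : E) = 0)
    (hF : Fintype.card F = q) (hq : 3 ≤ q) (hγ : IsPrimitiveRoot γ (q + 1))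
    {C : Submodule F (Fin (q + 1) → F)}
    (hC : ∀ c : Fin (q + 1) → F, c ∈ C ↔ ((∑ i : Fin (q + 1), c i • γ ^ (i : ℕ)) = 0 ∧
      (∑ i : Fin (q + 1), c i • γ ^ (2 * (i : ℕ))) = 0))
    {w : Fin (q + 1 + 1) → F} (hw : w ∈ extendedCode C) (h0 : w ≠ 0) : 5 ≤ wt w := by
  classical
  by_contra! hwt
  have hγ0 : γ ≠ 0 := hγ.ne_zero (by omega)
  obtain ⟨hwC, hsum⟩ := mem_extendedCode.mp hw
  obtain ⟨p1, p2⟩ := (hC _).mp hwC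
  have frob := fun y : E => congrFun (FiniteField.coe_frobeniusAlgHom F E) y
  have hinv : ∀ k : ℕ, (γ ^ k) ^ q = (γ ^ k)⁻¹ := fun k =>
    eq_inv_of_mul_eq_one_left (by rw [← pow_succ, pow_right_comm, hγ.pow_eq_one, one_pow])
  have n1 := congrArg (FiniteField.frobeniusAlgHom F E) p1
  have n2 := congrArg (FiniteField.frobeniusAlgHom F E) p2
  simp only [map_sum, map_smul, map_zero] at n1 n2
  simp only [frob, hF, hinv] at n1 n2
  let x : Fin (q + 1) → E := fun i => γ ^ (i : ℕ)
  let d : Fin (q + 1) → E := fun i => w i.castSucc • (x i ^ 2)⁻¹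
  have hx : Function.Injective x := fun i j h => Fin.ext (hγ.pow_inj i.2 j.2 h)
  have hx0 : ∀ i, x i ≠ 0 := fun i => pow_ne_zero _ hγ0
  have hpow : ∀ i : Fin (q + 1), γ ^ (2 * (i : ℕ)) = x i ^ 2 := fun i => by
    rw [mul_comm, pow_mul]
  have m0 : ∑ i, d i = 0 := by simpa only [d, hpow] using n2
  have m1 : ∑ i, d i * x i = 0 := by
    rw [← n1]
    refine Finset.sum_congr rfl fun i _ => ?_
    have := hx0 i
    simp only [d, smul_mul_assoc]
    congr 1
    change _ = (x i)⁻¹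
    field_simp
  have m3 : ∑ i, d i * x i ^ 3 = 0 := by
    rw [← p1]
    refine Finset.sum_congr rfl fun i _ => ?_
    have := hx0 i
    simp only [d, smul_mul_assoc]
    congr 1
    change _ = x i
    field_simp
  have m4 : ∑ i, d i * x i ^ 4 = 0 := by
    rw [← p2]
    refine Finset.sum_congr rfl fun i _ => ?_
    have := hx0 i
    simp only [d, smul_mul_assoc, hpow]
    congr 1
    field_simp
  set S : Finset (Fin (q + 1)) := Finset.univ.filter fun i => w i.castSucc ≠ 0 with hS
  have hdS : ∀ i, d i ≠ 0 → i ∈ S := fun i hi => by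
    simp only [hS, Finset.mem_filter, Finset.mem_univ, true_and]
    rintro h
    simp [d, h] at hi
  have hd : d = 0 := by
    by_cases hl : w (Fin.last _) = 0
    · have hcard : S.card ≤ 4 := by
        rw [wt_eq_card] at hwt
        rw [← Finset.card_map Fin.castSuccEmb]
        refine (Finset.card_le_card fun j hj => ?_).trans (Nat.le_of_lt_succ hwt)
        obtain ⟨i, hi, rfl⟩ := Finset.mem_map.mp hj
        simpa [hS] using hi
      obtain ⟨T, hST, hT⟩ := Finset.exists_superset_card_eq hcard (by simp; omega)
      refine eq_zero_of_moments_four hx hT (fun i hi => hST (hdS i hi)) m0 m1 ?_ m3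
      rw [Fin.sum_univ_castSucc, hl, add_zero] at hsum
      rw [← map_zero (algebraMap F E), ← hsum, map_sum]
      refine Finset.sum_congr rfl fun i _ => ?_
      have := hx0 i
      simp only [d, Algebra.smul_def]
      field_simp
    · have hcard : S.card ≤ 3 := by
        rw [wt_eq_card] at hwt
        have : (insert (Fin.last _) (S.map Fin.castSuccEmb)).card ≤ 4 := by
          refine (Finset.card_le_card fun j hj => ?_).trans (Nat.le_of_lt_succ hwt)
          rcases Finset.mem_insert.mp hj with rfl | hj
          · simpa using hl
          · obtain ⟨i, hi, rfl⟩ := Finset.mem_map.mp hj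
            simpa [hS] using hi
        rw [Finset.card_insert_of_notMem (by simp), Finset.card_map] at this
        omega
      obtain ⟨T, hST, hT⟩ := Finset.exists_superset_card_eq hcard (by simp; omega)
      exact eq_zero_of_moments_three h3 hx hT (fun i hi => hST (hdS i hi)) m0 m1 m3 m4
  have hw0 : ∀ i : Fin (q + 1), w i.castSucc = 0 := fun i => by
    have := congrFun hd i
    simpa [d, hx0 i] using this
  refine h0 (funext fun i => Fin.lastCases ?_ hw0 i)
  simpa [Fin.sum_univ_castSucc, hw0] using hsum

/-- The points `±x, x γ, x γ⁻¹` of the unit circle have vanishing second elementary symmetric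
polynomial, so they support a word of the BCH code. -/
theorem exists_mem_extendedCode_wt_le_five [Fintype F] [Fintype E] {q : ℕ} {γ : E}
    (h3 : (3 : E) = 0) (hF : Fintype.card F = q) (hE : Fintype.card E = q ^ 2) (hq : 3 ≤ q)
    (hodd : Odd q) (hγ : IsPrimitiveRoot γ (q + 1)) {C : Submodule F (Fin (q + 1) → F)}
    (hC : ∀ c : Fin (q + 1) → F, c ∈ C ↔ ((∑ i : Fin (q + 1), c i • γ ^ (i : ℕ)) = 0 ∧
      (∑ i : Fin (q + 1), c i • γ ^ (2 * (i : ℕ))) = 0)) (k : Fin (q + 1)) :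
    ∃ w ∈ extendedCode C, w k.castSucc ≠ 0 ∧ w (Fin.last _) ≠ 0 ∧ wt w ≤ 5 := by
  classical
  have hγ0 : γ ≠ 0 := hγ.ne_zero (by omega)
  have hγ2 : γ ^ 2 ≠ 1 := hγ.pow_ne_one_of_pos_of_lt (by omega) (by omega)
  have h3F : (3 : F) = 0 := (algebraMap F E).injective (by rw [map_zero, map_ofNat, h3])
  have hγq : γ ^ q = γ⁻¹ := eq_inv_of_mul_eq_one_left (by rw [← pow_succ, hγ.pow_eq_one])
  set a := Algebra.trace F E γ
  have ha : algebraMap F E a = γ + γ⁻¹ := by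
    rw [algebraMap_trace_eq_add_pow hF hE, hγq]
  have ha1 : a - 1 ≠ 0 := fun h => by
    have h := congrArg (algebraMap F E) h
    rw [map_sub, ha, map_one, map_zero] at h
    field_simp at h
    have : γ = -1 := eq_neg_of_add_eq_zero_left
      (pow_eq_zero_iff two_ne_zero |>.mp (by linear_combination h + γ * h3))
    exact hγ2 (by rw [this]; ring)
  have ha2 : a + 1 ≠ 0 := fun h => by
    have h := congrArg (algebraMap F E) h
    rw [map_add, ha, map_one, map_zero] at h
    field_simp at h
    have : γ = 1 := eq_of_sub_eq_zero
      (pow_eq_zero_iff two_ne_zero |>.mp (by linear_combination h - γ * h3))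
    exact hγ2 (by rw [this]; ring)
  set x := γ ^ (k : ℕ) with hx
  have hx0 : x ≠ 0 := pow_ne_zero _ hγ0
  have hxq : x ^ (q + 1) = 1 := by rw [hx, pow_right_comm, hγ.pow_eq_one, one_pow]
  have index : ∀ y : E, y ^ (q + 1) = 1 → ∃ i : Fin (q + 1), γ ^ (i : ℕ) = y := fun y hy => by
    obtain ⟨i, hi, h⟩ := hγ.eq_pow_of_pow_eq_one hy
    exact ⟨⟨i, hi⟩, h⟩
  obtain ⟨i₁, h₁⟩ := index (-x) (by rw [hodd.add_one.neg_pow, hxq])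
  obtain ⟨i₂, h₂⟩ := index (x * γ) (by rw [mul_pow, hxq, hγ.pow_eq_one, one_mul])
  obtain ⟨i₃, h₃⟩ := index (x * γ⁻¹)
    (by rw [mul_pow, hxq, inv_pow, hγ.pow_eq_one, inv_one, one_mul])
  have hE2 : (2 : E) ≠ 0 := fun h => one_ne_zero (α := E) (by linear_combination h3 - h)
  have hk₁ : k ≠ i₁ := fun h => by
    rw [← h, ← hx] at h₁
    exact mul_ne_zero hE2 hx0 (by linear_combination h₁)
  have hk₂ : k ≠ i₂ := fun h => by
    rw [← h, ← hx] at h₂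
    have : γ = 1 := mul_left_cancel₀ hx0 (by rw [← h₂, mul_one])
    exact hγ2 (by rw [this, one_pow])
  have hk₃ : k ≠ i₃ := fun h => by
    rw [← h, ← hx] at h₃
    have : γ⁻¹ = 1 := mul_left_cancel₀ hx0 (by rw [← h₃, mul_one])
    exact hγ2 (by rw [inv_eq_one.mp this, one_pow])
  let c : Fin (q + 1) → F := Pi.single k ((a - 1) ^ 2) + Pi.single i₁ ((a + 1) ^ 2) +
    Pi.single i₂ 1 + Pi.single i₃ 1
  have hc : ∀ f : Fin (q + 1) → E, ∑ i, c i • f i =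
      (γ + γ⁻¹ - 1) ^ 2 * f k + (γ + γ⁻¹ + 1) ^ 2 * f i₁ + f i₂ + f i₃ := fun f => by
    have hs : ∀ (j : Fin (q + 1)) (t : F), ∑ i, (Pi.single j t : Fin (q + 1) → F) i • f i =
        algebraMap F E t * f j := fun j t => by
      rw [Finset.sum_eq_single j (fun i _ hi => by rw [Pi.single_eq_of_ne hi, zero_smul])
        (by simp), Pi.single_eq_same, Algebra.smul_def]
    simp only [c, Pi.add_apply, add_smul, Finset.sum_add_distrib, hs]
    simp [ha]
  have hcsum : ∑ i, c i = (a - 1) ^ 2 + (a + 1) ^ 2 + 1 + 1 := by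
    simp [c, Finset.sum_add_distrib]
  refine ⟨Fin.snoc c (-∑ i, c i), mem_extendedCode.mpr ⟨?_, ?_⟩, ?_, ?_, ?_⟩
  · simp only [Fin.snoc_castSucc]
    refine (hC c).mpr ⟨?_, ?_⟩
    · rw [hc, ← hx, h₁, h₂, h₃]
      linear_combination (-x * (γ + γ⁻¹)) * h3
    · rw [hc]
      simp only [mul_comm 2, pow_mul]
      rw [← hx, h₁, h₂, h₃]
      have : γ * γ⁻¹ = 1 := mul_inv_cancel₀ hγ0
      linear_combination (γ + γ⁻¹) ^ 2 * x ^ 2 * h3 - 2 * x ^ 2 * this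
  · simp [Fin.sum_univ_castSucc]
  · simpa [c, hk₁, hk₂, hk₃] using ha1
  · rw [Fin.snoc_last, hcsum]
    intro h
    exact mul_ne_zero ha1 ha2 (by linear_combination h + (a ^ 2 + 1) * h3F)
  · refine (wt_le_card (S := {k.castSucc, i₁.castSucc, i₂.castSucc, i₃.castSucc, Fin.last _})
      fun j => ?_).trans Finset.card_le_five
    refine Fin.lastCases (by simp) (fun i => ?_) j
    contrapose!
    intro h
    simp only [Finset.mem_insert, Finset.mem_singleton, not_or, Fin.castSucc_inj] at h
    simp [c, h.1, h.2.1, h.2.2.1, h.2.2.2.1]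

theorem sub_three_le_wt_traceWord [Fintype F] [Fintype E] {q : ℕ} {γ : E}
    (hF : Fintype.card F = q) (hE : Fintype.card E = q ^ 2) (hγ : IsPrimitiveRoot γ (q + 1))
    {v : F × E × E} (hv : v ≠ 0) : q - 3 ≤ wt (traceWord γ (q + 1) v) := by
  classical
  have h := card_zeros_traceWord_le hF hE hγ hv
    (S := Finset.univ.filter fun i : Fin (q + 1) => traceWord γ (q + 1) v i.castSucc = 0)
    (fun i hi => by simpa using hi)
  have h2 := Finset.card_filter_add_card_filter_not (s := Finset.univ)
    (fun i : Fin (q + 1) => traceWord γ (q + 1) v i.castSucc = 0)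
  rw [Finset.card_univ, Fintype.card_fin] at h2
  have h4 : (Finset.univ.filter fun i : Fin (q + 1) =>
      ¬ traceWord γ (q + 1) v i.castSucc = 0).card ≤ wt (traceWord γ (q + 1) v) := by
    rw [wt_eq_card, ← Finset.card_map Fin.castSuccEmb]
    refine Finset.card_le_card fun j hj => ?_
    obtain ⟨i, hi, rfl⟩ := Finset.mem_map.mp hj
    simpa using hi
  omega

theorem exists_wt_traceWord_le [Fintype F] [Fintype E] {q : ℕ} {γ : E}
    (hE2 : (2 : E) ≠ 0) (hF : Fintype.card F = q) (hE : Fintype.card E = q ^ 2) (hq : 3 ≤ q)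
    (hodd : Odd q) (hγ : IsPrimitiveRoot γ (q + 1)) :
    ∃ v : F × E × E, v ≠ 0 ∧ wt (traceWord γ (q + 1) v) ≤ q - 3 := by
  classical
  have hγ0 : γ ≠ 0 := hγ.ne_zero (by omega)
  have hγ2 : γ ^ 2 ≠ 1 := hγ.pow_ne_one_of_pos_of_lt (by omega) (by omega)
  have hγq : γ ^ q = γ⁻¹ := eq_inv_of_mul_eq_one_left (by rw [← pow_succ, hγ.pow_eq_one])
  have hinv : γ * γ⁻¹ = 1 := mul_inv_cancel₀ hγ0
  have hδ0 : γ - γ⁻¹ ≠ 0 := fun h => hγ2 (by linear_combination γ * h + hinv)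
  have frob := fun y : E => congrFun (FiniteField.coe_frobeniusAlgHom F E) y
  simp only [hF] at frob
  have hδq : (γ - γ⁻¹) ^ q = -(γ - γ⁻¹) := by
    rw [← frob, map_sub, frob, frob, inv_pow, hγq, inv_inv, neg_sub]
  have hAq : (γ + γ⁻¹) ^ q = γ + γ⁻¹ := by
    rw [← frob, map_add, frob, frob, inv_pow, hγq, inv_inv, add_comm]
  let v : F × E × E := (0, -((γ + γ⁻¹) * (γ - γ⁻¹)), γ - γ⁻¹)
  have hzero : ∀ i : Fin (q + 1), γ ^ (i : ℕ) ∈ ({1, -1, γ, γ⁻¹} : Finset E) →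
      traceWord γ (q + 1) v i.castSucc = 0 := fun i hi => by
    apply (algebraMap F E).injective
    rw [traceWord_castSucc, mul_comm 2, pow_mul]
    simp only [map_add, algebraMap_trace_eq_add_pow hF hE, map_zero, v]
    simp only [hodd.neg_pow, neg_mul, mul_pow, hδq, hAq, ← pow_right_comm _ q 2]
    simp only [Finset.mem_insert, Finset.mem_singleton] at hi
    rcases hi with hi | hi | hi | hi
    · rw [hi, one_pow]
      ring
    · rw [hi, hodd.neg_one_pow]
      ring
    · rw [hi, hγq]
      ring
    · rw [hi, inv_pow, hγq, inv_inv]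
      ring
  have hmem : ∀ y ∈ ({1, -1, γ, γ⁻¹} : Finset E), y ^ (q + 1) = 1 := by
    simp [hodd.add_one.neg_pow, hγ.pow_eq_one]
  have hcard : ({1, -1, γ, γ⁻¹} : Finset E).card = 4 := by
    have h1 : (1 : E) ≠ -1 := fun h => hE2 (by linear_combination h)
    have h2 : (1 : E) ≠ γ := fun h => hγ2 (by rw [← h, one_pow])
    have h3 : (1 : E) ≠ γ⁻¹ := fun h => h2 (by rw [← inv_inv γ, ← h, inv_one])
    have h4 : -1 ≠ γ := fun h => hγ2 (by rw [← h]; ring)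
    have h5 : -1 ≠ γ⁻¹ := fun h => h4 (by rw [← inv_inv γ, ← h, inv_neg, inv_one])
    have h6 : γ ≠ γ⁻¹ := fun h => hδ0 (sub_eq_zero.mpr h)
    rw [Finset.card_insert_of_notMem (by simp [h1, h2, h3]),
      Finset.card_insert_of_notMem (by simp [h4, h5]), Finset.card_pair h6]
  refine ⟨v, fun h => hδ0 (congrArg (·.2.2) h), ?_⟩
  set S : Finset (Fin (q + 1)) :=
    Finset.univ.filter fun i => γ ^ (i : ℕ) ∈ ({1, -1, γ, γ⁻¹} : Finset E) with hS
  have hScard : 4 ≤ S.card := by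
    rw [← hcard]
    refine (Finset.card_le_card fun y hy => ?_).trans
      (Finset.card_image_le (s := S) (f := fun i : Fin (q + 1) => γ ^ (i : ℕ)))
    obtain ⟨i, hi, rfl⟩ := hγ.eq_pow_of_pow_eq_one (hmem y hy)
    exact Finset.mem_image.mpr ⟨⟨i, hi⟩, by simpa [hS] using hy, rfl⟩
  refine (wt_le_card (S := Sᶜ.map Fin.castSuccEmb) fun j => ?_).trans ?_
  · refine Fin.lastCases (fun h => absurd (traceWord_last γ (q + 1) v) h) (fun i hi => ?_) j
    refine Finset.mem_map.mpr ⟨i, Finset.mem_compl.mpr fun hiS => hi (hzero i ?_), rfl⟩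
    exact (Finset.mem_filter.mp hiS).2
  · rw [Finset.card_map, Finset.card_compl, Fintype.card_fin]
    omega

end

/-- Let `q = 3^s`, `s ≥ 2`, `GF(q) ⊆ GF(q²)`, and `γ ∈ GF(q²)` of
multiplicative order `q + 1`. Let `C` be the narrow-sense BCH code
`{c : Σ cᵢ γ^i = 0 and Σ cᵢ γ^(2i) = 0}` of length `q + 1` over `GF(q)`. Then the extended
code `C̄` has dimension `q - 3` and minimum distance `5`, its dual has dimension `5` and
minimum distance `q - 3`, and `(C̄)⊥` has minimum linear locality `4`. -/
theorem statement17 {F E : Type*} [Field F] [Fintype F] [Field E] [Fintype E] [Algebra F E]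
    (s q : ℕ) (hs : 2 ≤ s) (hq : q = 3 ^ s)
    (hF : Fintype.card F = q) (hE : Fintype.card E = q ^ 2)
    (γ : E) (hγ : orderOf γ = q + 1)
    (C : Submodule F (Fin (q + 1) → F))
    (hC : ∀ c : Fin (q + 1) → F, c ∈ C ↔
      ((∑ i : Fin (q + 1), c i • γ ^ (i : ℕ)) = 0 ∧
        (∑ i : Fin (q + 1), c i • γ ^ (2 * (i : ℕ))) = 0)) :
    Module.finrank F (extendedCode C) = q - 3 ∧
    minDist (extendedCode C) = 5 ∧
    Module.finrank F (dualCode (extendedCode C)) = 5 ∧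
    minDist (dualCode (extendedCode C)) = q - 3 ∧
    IsLeast {r : ℕ | HasLinearLocality (dualCode (extendedCode C)) r} 4 := by
  have hq9 : 9 ≤ q := hq ▸ Nat.pow_le_pow_right (n := 3) (by norm_num) hs
  have hodd : Odd q := hq ▸ Odd.pow (by decide)
  have h3 : (3 : E) = 0 := by
    have h := FiniteField.cast_card_eq_zero E
    rw [hE, hq, ← pow_mul] at h
    push_cast at h
    exact pow_eq_zero_iff (by omega) |>.mp h
  have hE2 : (2 : E) ≠ 0 := fun h => one_ne_zero (α := E) (by linear_combination h3 - h)
  have hprim : IsPrimitiveRoot γ (q + 1) := hγ ▸ IsPrimitiveRoot.orderOf γ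
  have hdual : dualCode (extendedCode C) = LinearMap.range (traceWord (F := F) γ (q + 1)) := by
    rw [← dualCode_range_traceWord hC, dualCode_dualCode]
  have hinj : Function.Injective (traceWord (F := F) γ (q + 1)) := by
    rw [← LinearMap.ker_eq_bot, LinearMap.ker_eq_bot']
    intro v hv
    by_contra h0
    have h := sub_three_le_wt_traceWord hF hE hprim h0
    rw [hv] at h
    simp only [wt, Pi.zero_apply, ne_eq, not_true_eq_false] at h
    simp at h
    omega
  have hdim : Module.finrank F (dualCode (extendedCode C)) = 5 := by
    rw [hdual, LinearMap.finrank_range_of_inj hinj, Module.finrank_prod, Module.finrank_prod,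
      finrank_eq_two hF hE, Module.finrank_self]
  have hlow : ∀ w ∈ extendedCode C, w ≠ 0 → 5 ≤ wt w := fun w hw h0 =>
    five_le_wt_of_mem_extendedCode h3 hF (by omega) hprim hC hw h0
  have hword := exists_mem_extendedCode_wt_le_five h3 hF hE (by omega) hodd hprim hC
  refine ⟨?_, minDist_eq hlow ?_, hdim, minDist_eq ?_ ?_, ?_, ?_⟩
  · have h := finrank_add_finrank_dualCode (extendedCode C)
    rw [hdim, Fintype.card_fin] at h
    omega
  · obtain ⟨w, hw, h0, -, hwt⟩ := hword 0
    exact ⟨w, hw, fun h => h0 (by rw [h, Pi.zero_apply]), hwt⟩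
  · rw [hdual]
    rintro _ ⟨v, rfl⟩ h0
    exact sub_three_le_wt_traceWord hF hE hprim fun h => h0 (by rw [h, map_zero])
  · obtain ⟨v, h0, hwt⟩ := exists_wt_traceWord_le (F := F) hE2 hF hE (by omega) hodd hprim
    exact ⟨_, hdual ▸ ⟨v, rfl⟩, (map_ne_zero_iff _ hinj).mpr h0, hwt⟩
  · refine hasLinearLocality_dualCode_iff.mpr fun i => ?_
    refine Fin.lastCases ?_ (fun i => ?_) i
    · obtain ⟨w, hw, -, h, hwt⟩ := hword 0
      exact ⟨w, hw, h, hwt⟩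
    · obtain ⟨w, hw, h, -, hwt⟩ := hword i
      exact ⟨w, hw, h, hwt⟩
  · intro r hr
    obtain ⟨w, hw, h, hwt⟩ := hasLinearLocality_dualCode_iff.mp hr (Fin.last _)
    have := hlow w hw fun h0 => h (by rw [h0, Pi.zero_apply])
    omega
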